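/- For every n ≥ 1 and every k ≥ 0, the number of permutations of [n] with exactly k up-down runs equals the number of increasing trees on {0,1,…,n} with exactly k nonroot vertices of even degree. -/

import Mathlib

/-- The `i`-th entry (1-indexed) of the permutation `σ` of `[n]`, with the
convention that positions `0` and `> n` carry the entry `0`. -/
def permEntry (n : ℕ) (σ : Equiv.Perm (Fin n)) (i : ℕ) : ℕ :=
  if h : 1 ≤ i ∧ i ≤ n then ((σ ⟨i - 1, by omega⟩ : Fin n) : ℕ) + 1 else 0

/-- The number of left peaks of `σ`: indices `1 ≤ i ≤ n-1` with
`σ_{i-1} < σ_i > σ_{i+1}`, convention `σ₀ = 0`. -/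
def leftPeakCount (n : ℕ) (σ : Equiv.Perm (Fin n)) : ℕ :=
  ((Finset.Icc 1 (n - 1)).filter fun i =>
    permEntry n σ (i - 1) < permEntry n σ i ∧ permEntry n σ (i + 1) < permEntry n σ i).card

/-- The number of exterior peaks of `σ`: indices `1 ≤ i ≤ n` with
`σ_{i-1} < σ_i > σ_{i+1}`, conventions `σ₀ = σ_{n+1} = 0`. -/
def extPeakCount (n : ℕ) (σ : Equiv.Perm (Fin n)) : ℕ :=
  ((Finset.Icc 1 n).filter fun i =>
    permEntry n σ (i - 1) < permEntry n σ i ∧ permEntry n σ (i + 1) < permEntry n σ i).card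

/-- The number of interior peaks of `σ`: indices `2 ≤ i ≤ n-1` with
`σ_{i-1} < σ_i > σ_{i+1}`. -/
def intPeakCount (n : ℕ) (σ : Equiv.Perm (Fin n)) : ℕ :=
  ((Finset.Icc 2 (n - 1)).filter fun i =>
    permEntry n σ (i - 1) < permEntry n σ i ∧ permEntry n σ (i + 1) < permEntry n σ i).card

/-- The number of up-down runs of `σ`: maximal monotone segments of the
extended sequence `0, σ₁, …, σₙ`, i.e. one more than the number of direction
changes of that sequence (and `0` for `n = 0`). -/
def udRunCount (n : ℕ) (σ : Equiv.Perm (Fin n)) : ℕ :=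
  if n = 0 then 0 else
    1 + ((Finset.Icc 1 (n - 1)).filter fun i =>
      (permEntry n σ (i - 1) < permEntry n σ i ∧ permEntry n σ (i + 1) < permEntry n σ i) ∨
      (permEntry n σ i < permEntry n σ (i - 1) ∧ permEntry n σ i < permEntry n σ (i + 1))).card

/-- The number of alternating runs of `σ`: maximal monotone segments of
`σ₁, …, σₙ`, i.e. one more than the number of direction changes (and `0` for `n = 0`). -/
def altRunCount (n : ℕ) (σ : Equiv.Perm (Fin n)) : ℕ :=
  if n = 0 then 0 else
    1 + ((Finset.Icc 2 (n - 1)).filter fun i =>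
      (permEntry n σ (i - 1) < permEntry n σ i ∧ permEntry n σ (i + 1) < permEntry n σ i) ∨
      (permEntry n σ i < permEntry n σ (i - 1) ∧ permEntry n σ i < permEntry n σ (i + 1))).card

/-- `L n k` : the number of permutations of `[n]` with exactly `k` left peaks. -/
def leftPeakNum (n k : ℕ) : ℕ :=
  (Finset.univ.filter fun σ : Equiv.Perm (Fin n) => leftPeakCount n σ = k).card

/-- `W n k` : the number of permutations of `[n]` with exactly `k` exterior peaks. -/
def extPeakNum (n k : ℕ) : ℕ :=
  (Finset.univ.filter fun σ : Equiv.Perm (Fin n) => extPeakCount n σ = k).card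

/-- `M n k` : the number of permutations of `[n]` with exactly `k` interior peaks. -/
def intPeakNum (n k : ℕ) : ℕ :=
  (Finset.univ.filter fun σ : Equiv.Perm (Fin n) => intPeakCount n σ = k).card

/-- `Λ n k` : the number of permutations of `[n]` with exactly `k` up-down runs. -/
def udRunNum (n k : ℕ) : ℕ :=
  (Finset.univ.filter fun σ : Equiv.Perm (Fin n) => udRunCount n σ = k).card

/-- `R n k` : the number of permutations of `[n]` with exactly `k` alternating runs. -/
def altRunNum (n k : ℕ) : ℕ :=
  (Finset.univ.filter fun σ : Equiv.Perm (Fin n) => altRunCount n σ = k).card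

/-- An increasing tree on `{0,1,…,n}`: the datum of a parent function sending each
nonroot vertex `i+1` (encoded as `i : Fin n`) to a parent `p i < i + 1`. -/
def IncTree (n : ℕ) := {p : Fin n → Fin (n + 1) // ∀ i : Fin n, (p i : ℕ) ≤ (i : ℕ)}

instance (n : ℕ) : Fintype (IncTree n) := Subtype.fintype _

instance (n : ℕ) : DecidableEq (IncTree n) := Subtype.instDecidableEq

/-- The degree (number of children) of the vertex `v` in the increasing tree `T`. -/
def treeDeg {n : ℕ} (T : IncTree n) (v : Fin (n + 1)) : ℕ :=
  (Finset.univ.filter fun i : Fin n => T.1 i = v).card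

/-- The number of nonroot vertices of even degree of the increasing tree `T`. -/
def evenNonrootCount {n : ℕ} (T : IncTree n) : ℕ :=
  (Finset.univ.filter fun v : Fin (n + 1) => v ≠ 0 ∧ Even (treeDeg T v)).card

open Finset

/-- The number of letter changes in the word `b :: w`. -/
def changeCount : Bool → List Bool → ℕ
  | _, [] => 0
  | b, c :: w => (if b = c then 0 else 1) + changeCount c w

/-- The words obtained from `w` by replacing one letter by `true, false`, or by appending `true`.
These are the ascent words of the sequences obtained by inserting a new maximum into a sequence
with ascent word `w`. -/
def maxInsertions : List Bool → List (List Bool)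
  | [] => [[true]]
  | c :: w => (true :: false :: w) :: (maxInsertions w).map (c :: ·)

theorem changeCount_le_length (b : Bool) (w : List Bool) : changeCount b w ≤ w.length := by
  induction w generalizing b with
  | nil => simp [changeCount]
  | cons c w ih =>
    have := ih c
    simp only [changeCount, List.length_cons]
    split_ifs <;> omega

/-- The weight of a node with statistic `r` and size `n` in the generating tree where such a node
has `r` children of statistic `r`, one of statistic `r + 1` and `n - r` of statistic `r + 2`. -/
def runWeight (n : ℕ) (φ : ℕ → ℕ) (r : ℕ) : ℕ :=
  r * φ r + φ (r + 1) + (n - r) * φ (r + 2)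

theorem sum_maxInsertions (φ : ℕ → ℕ) (w : List Bool) :
    ((maxInsertions w).map fun c => φ (changeCount false c)).sum =
      runWeight w.length φ (changeCount false w) := by
  match w with
  | [] => simp [maxInsertions, changeCount, runWeight]
  | [true] => simp [maxInsertions, changeCount, runWeight, add_comm]
  | false :: w =>
    have ih := sum_maxInsertions φ w
    have hle := changeCount_le_length false w
    obtain ⟨d, hd⟩ := Nat.exists_eq_add_of_le hle
    simp only [runWeight] at ih
    simp only [maxInsertions, List.map_cons, List.map_map, List.sum_cons, Function.comp_def,
      changeCount, List.length_cons, runWeight, if_true, zero_add, ih]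
    rw [hd]
    simp [add_assoc]
    ring_nf
  | true :: true :: w =>
    have ih := sum_maxInsertions φ (true :: w)
    have hle := changeCount_le_length true w
    obtain ⟨d, hd⟩ := Nat.exists_eq_add_of_le hle
    simp only [runWeight, maxInsertions, List.map_cons, List.map_map, List.sum_cons,
      Function.comp_def, changeCount, List.length_cons, if_true, zero_add] at ih ⊢
    rw [hd] at ih ⊢
    rw [show changeCount true w + d + 1 + 1 - ((if false = true then 0 else 1) +
      changeCount true w) = d + 1 by simp; omega]
    rw [show changeCount true w + d + 1 - ((if false = true then 0 else 1) +
      changeCount true w) = d by simp; omega] at ih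
    simp at ih ⊢
    ring_nf at ih ⊢
    omega
  | true :: false :: w =>
    have ih := sum_maxInsertions (fun r => φ (1 + (1 + r))) w
    have hle := changeCount_le_length false w
    obtain ⟨d, hd⟩ := Nat.exists_eq_add_of_le hle
    simp only [runWeight, maxInsertions, List.map_cons, List.map_map, List.sum_cons,
      Function.comp_def, changeCount, List.length_cons, if_true, zero_add] at ih ⊢
    rw [hd] at ih ⊢
    rw [show changeCount false w + d - changeCount false w = d by omega] at ih
    rw [show changeCount false w + d + 1 + 1 - ((if false = true then 0 else 1) +
      ((if true = false then 0 else 1) + changeCount false w)) = d by simp; omega]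
    simp at ih ⊢
    rw [ih]
    ring_nf
termination_by w.length

/-- The word `a 0, …, a (n - 1)`. -/
def prefixWord (a : ℕ → Bool) (n : ℕ) : List Bool := (List.range n).map a

theorem prefixWord_succ (a : ℕ → Bool) (n : ℕ) :
    prefixWord a (n + 1) = a 0 :: prefixWord (fun i => a (i + 1)) n := by
  simp [prefixWord, List.range_succ_eq_map, Function.comp_def]

theorem prefixWord_congr {a b : ℕ → Bool} {n : ℕ} (h : ∀ i < n, a i = b i) :
    prefixWord a n = prefixWord b n :=
  List.map_congr_left fun i hi => h i (List.mem_range.1 hi)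

theorem changeCount_prefixWord_succ (b : Bool) (a : ℕ → Bool) (n : ℕ) :
    changeCount b (prefixWord a (n + 1)) =
      (if b = a 0 then 0 else 1) + ∑ i ∈ range n, if a i = a (i + 1) then 0 else 1 := by
  induction n generalizing a b with
  | zero => simp [prefixWord, changeCount]
  | succ n ih =>
    rw [prefixWord_succ, changeCount, ih, Finset.sum_range_succ']
    ring

/-- The ascent sequence after inserting a new maximum into the `g`-th gap. -/
def insertAscent (a : ℕ → Bool) (g p : ℕ) : Bool :=
  if p < g then a p else if p = g then true else if p = g + 1 then false else a (p - 1)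

theorem sum_insertAscent (ψ : List Bool → ℕ) (a : ℕ → Bool) (n : ℕ) :
    ∑ g ∈ range (n + 1), ψ (prefixWord (insertAscent a g) (n + 1)) =
      ((maxInsertions (prefixWord a n)).map ψ).sum := by
  induction n generalizing a ψ with
  | zero => simp [prefixWord, maxInsertions, insertAscent]
  | succ n ih =>
    rw [Finset.sum_range_succ', prefixWord_succ a, maxInsertions, List.map_cons, List.sum_cons,
      List.map_map, Function.comp_def, ← ih, add_comm]
    congr 1
    · rw [prefixWord_succ, prefixWord_succ]
      congr 1
    · refine Finset.sum_congr rfl fun g _ => ?_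
      rw [prefixWord_succ]
      congr 2
      refine prefixWord_congr fun i _ => ?_
      rcases i with _ | i <;> rcases g with _ | g <;> simp [insertAscent]

theorem permEntry_zero (n : ℕ) (σ : Equiv.Perm (Fin n)) : permEntry n σ 0 = 0 := by
  simp [permEntry]

theorem permEntry_succ {n : ℕ} (σ : Equiv.Perm (Fin n)) (j : Fin n) :
    permEntry n σ (j + 1) = σ j + 1 := by
  have := j.2
  rw [permEntry, dif_pos (by omega)]
  simp

theorem permEntry_le (n : ℕ) (σ : Equiv.Perm (Fin n)) (i : ℕ) : permEntry n σ i ≤ n := by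
  unfold permEntry
  split_ifs <;> omega

theorem permEntry_ne_succ {n : ℕ} (σ : Equiv.Perm (Fin n)) {i : ℕ} (hi : i < n) :
    permEntry n σ i ≠ permEntry n σ (i + 1) := by
  rw [permEntry_succ σ ⟨i, hi⟩]
  rcases i with _ | i
  · simp [permEntry_zero]
  · rw [permEntry_succ σ ⟨i, by omega⟩]
    simp [Fin.val_inj]

/-- The ascent sequence of `0, σ₁, …, σₙ`. -/
def permAscent (n : ℕ) (σ : Equiv.Perm (Fin n)) (i : ℕ) : Bool :=
  decide (permEntry n σ i < permEntry n σ (i + 1))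

theorem udRunCount_eq_changeCount (n : ℕ) (σ : Equiv.Perm (Fin n)) :
    udRunCount n σ = changeCount false (prefixWord (permAscent n σ) n) := by
  rcases n with _ | n
  · simp [udRunCount, prefixWord, changeCount]
  have h0 : permAscent (n + 1) σ 0 = true := by
    have := permEntry_succ σ 0
    simp only [Fin.val_zero, zero_add] at this
    simp [permAscent, permEntry_zero, this]
  rw [changeCount_prefixWord_succ, h0, udRunCount, if_neg n.succ_ne_zero, Finset.card_filter,
    Nat.add_sub_cancel, if_neg Bool.false_ne_true, ← Finset.Ico_add_one_right_eq_Icc,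
    Finset.sum_Ico_eq_sum_range, Nat.add_sub_cancel]
  congr 1
  refine Finset.sum_congr rfl fun i hi => ?_
  rw [Finset.mem_range] at hi
  have h1 := permEntry_ne_succ σ (show i < n + 1 by omega)
  have h2 := permEntry_ne_succ σ (show i + 1 < n + 1 by omega)
  simp only [permAscent, add_comm 1 i, Nat.add_sub_cancel, decide_eq_decide]
  split_ifs <;> omega

/-- Insert a new maximum into the `g`-th gap of a permutation. -/
def insertMax {n : ℕ} (x : Equiv.Perm (Fin n) × Fin (n + 1)) : Equiv.Perm (Fin (n + 1)) :=
  (finSuccEquiv' x.2).trans ((Equiv.optionCongr x.1).trans (finSuccEquiv' (Fin.last n)).symm)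

theorem insertMax_apply_self {n : ℕ} (x : Equiv.Perm (Fin n) × Fin (n + 1)) :
    insertMax x x.2 = Fin.last n := by
  simp [insertMax]

theorem insertMax_apply_succAbove {n : ℕ} (x : Equiv.Perm (Fin n) × Fin (n + 1)) (j : Fin n) :
    insertMax x (x.2.succAbove j) = (x.1 j).castSucc := by
  simp [insertMax]

theorem insertMax_bijective (n : ℕ) : Function.Bijective (insertMax (n := n)) := by
  rw [Fintype.bijective_iff_injective_and_card]
  constructor
  · rintro ⟨σ, g⟩ ⟨τ, h⟩ heq
    have hgh : g = h := by
      have h1 := insertMax_apply_self (σ, g)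
      rw [heq, ← insertMax_apply_self (τ, h)] at h1
      exact (insertMax (τ, h)).injective h1
    subst hgh
    congr 1
    ext j
    have h1 := insertMax_apply_succAbove (σ, g) j
    rw [heq, insertMax_apply_succAbove] at h1
    simpa [Fin.ext_iff] using h1.symm
  · simp [Fintype.card_perm, Nat.factorial_succ, mul_comm]

theorem permEntry_insertMax {n : ℕ} (σ : Equiv.Perm (Fin n)) (g : Fin (n + 1)) {p : ℕ}
    (hp : p ≤ n + 1) :
    permEntry (n + 1) (insertMax (σ, g)) p =
      if p ≤ g then permEntry n σ p else if p = g + 1 then n + 1 else permEntry n σ (p - 1) := by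
  have hg := g.2
  rcases p with _ | p
  · simp [permEntry_zero]
  rw [permEntry_succ _ ⟨p, by omega⟩]
  rcases lt_trichotomy p (g : ℕ) with h | h | h
  · have h1 := insertMax_apply_succAbove (σ, g) ⟨p, by omega⟩
    rw [Fin.succAbove_of_castSucc_lt _ _ (by simpa [Fin.lt_def] using h)] at h1
    simp only [Fin.castSucc_mk] at h1
    rw [h1, if_pos (by omega), permEntry_succ σ ⟨p, by omega⟩]
    simp
  · have h1 := insertMax_apply_self (σ, g)
    rw [if_neg (by omega), if_pos (by omega), show (⟨p, by omega⟩ : Fin (n + 1)) = g from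
      Fin.ext h, h1]
    simp
  · obtain ⟨q, rfl⟩ : ∃ q, p = q + 1 := ⟨p - 1, by omega⟩
    have h1 := insertMax_apply_succAbove (σ, g) ⟨q, by omega⟩
    rw [Fin.succAbove_of_le_castSucc _ _ (by simp [Fin.le_def]; omega)] at h1
    simp only [Fin.succ_mk] at h1
    rw [h1, if_neg (by omega), if_neg (by omega), Nat.add_sub_cancel,
      permEntry_succ σ ⟨q, by omega⟩]
    simp

theorem permAscent_insertMax {n : ℕ} (σ : Equiv.Perm (Fin n)) (g : Fin (n + 1)) {p : ℕ}
    (hp : p < n + 1) :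
    permAscent (n + 1) (insertMax (σ, g)) p = insertAscent (permAscent n σ) g p := by
  have h1 := permEntry_le n σ p
  have h2 := permEntry_le n σ (p - 1)
  rw [permAscent, permEntry_insertMax σ g hp.le, permEntry_insertMax σ g hp, insertAscent]
  rcases lt_trichotomy p (g : ℕ) with h | h | h
  · simp [h, h.le, permAscent]
  · rw [if_pos h.le, if_neg (by omega), if_pos (by omega), if_neg (by omega), if_pos h]
    simp
    omega
  · obtain ⟨q, rfl⟩ : ∃ q, p = q + 1 := ⟨p - 1, by omega⟩
    have h3 := permEntry_le n σ (q + 1)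
    by_cases hq : q = g
    · subst hq
      simp
      omega
    · rw [if_neg (by omega), if_neg (by omega), if_neg (by omega), if_neg (by omega),
        if_neg (by omega), if_neg (by omega), if_neg (by omega)]
      simp [permAscent]

theorem sum_udRunCount_succ (n : ℕ) (φ : ℕ → ℕ) :
    ∑ σ : Equiv.Perm (Fin (n + 1)), φ (udRunCount (n + 1) σ) =
      ∑ σ : Equiv.Perm (Fin n), runWeight n φ (udRunCount n σ) := by
  rw [← (insertMax_bijective n).sum_comp, Fintype.sum_prod_type]
  refine Finset.sum_congr rfl fun σ _ => ?_
  have h := sum_maxInsertions φ (prefixWord (permAscent n σ) n)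
  rw [← sum_insertAscent (fun c => φ (changeCount false c)), Finset.sum_range] at h
  rw [udRunCount_eq_changeCount]
  simp only [udRunCount_eq_changeCount]
  simp only [prefixWord_congr fun p hp => permAscent_insertMax σ _ hp]
  rw [h]
  simp [prefixWord]

/-- Attach a new largest leaf to the vertex `v` of an increasing tree. -/
def attachLeaf {n : ℕ} (x : IncTree n × Fin (n + 1)) : IncTree (n + 1) :=
  ⟨Fin.snoc (α := fun _ => Fin (n + 2)) (fun i => (x.1.1 i).castSucc) x.2.castSucc, fun i => by
    induction i using Fin.lastCases with
    | last => have := x.2.2; simp; omega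
    | cast i => simpa using x.1.2 i⟩

theorem attachLeaf_bijective (n : ℕ) : Function.Bijective (attachLeaf (n := n)) := by
  constructor
  · rintro ⟨S, u⟩ ⟨T, v⟩ h
    have h' := congrArg Subtype.val h
    have hlast := congrFun h' (Fin.last n)
    simp only [attachLeaf, Fin.snoc_last, Fin.castSucc_inj] at hlast
    refine Prod.ext (Subtype.ext (funext fun i => ?_)) hlast
    simpa [attachLeaf] using congrFun h' i.castSucc
  · intro T
    refine ⟨(⟨fun i => ⟨T.1 i.castSucc, ?_⟩, fun i => by simpa using T.2 i.castSucc⟩,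
      ⟨T.1 (Fin.last n), ?_⟩), ?_⟩
    · have := T.2 i.castSucc
      simp at this
      omega
    · have := T.2 (Fin.last n)
      simp at this
      omega
    · refine Subtype.ext (funext fun i => ?_)
      induction i using Fin.lastCases <;> simp [attachLeaf]

theorem treeDeg_attachLeaf_last {n : ℕ} (T : IncTree n) (v : Fin (n + 1)) :
    treeDeg (attachLeaf (T, v)) (Fin.last (n + 1)) = 0 := by
  rw [treeDeg, Finset.card_eq_zero, Finset.filter_eq_empty_iff]
  intro i _
  induction i using Fin.lastCases <;> simp [attachLeaf, Fin.castSucc_ne_last]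

theorem treeDeg_attachLeaf_castSucc {n : ℕ} (T : IncTree n) (v u : Fin (n + 1)) :
    treeDeg (attachLeaf (T, v)) u.castSucc = treeDeg T u + if v = u then 1 else 0 := by
  simp only [treeDeg, Finset.card_filter, Fin.sum_univ_castSucc]
  simp [attachLeaf]

theorem evenNonrootCount_attachLeaf {n : ℕ} (T : IncTree n) (v : Fin (n + 1)) :
    evenNonrootCount (attachLeaf (T, v)) =
      if v = 0 then evenNonrootCount T + 1
      else if Even (treeDeg T v) then evenNonrootCount T else evenNonrootCount T + 2 := by
  have key : evenNonrootCount (attachLeaf (T, v)) =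
      (∑ u : Fin (n + 1), if u ≠ 0 ∧ Even (treeDeg T u + if v = u then 1 else 0) then 1 else 0)
        + 1 := by
    rw [evenNonrootCount, Finset.card_filter, Fin.sum_univ_castSucc, treeDeg_attachLeaf_last]
    simp [treeDeg_attachLeaf_castSucc]
  rw [key, evenNonrootCount, Finset.card_filter, ← Finset.add_sum_erase _ _ (mem_univ v),
    ← Finset.add_sum_erase _ (fun u => if u ≠ 0 ∧ Even (treeDeg T u) then 1 else 0) (mem_univ v)]
  have hrest : (∑ u ∈ univ.erase v,
      if u ≠ 0 ∧ Even (treeDeg T u + if v = u then 1 else 0) then 1 else 0) =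
      ∑ u ∈ univ.erase v, if u ≠ 0 ∧ Even (treeDeg T u) then 1 else 0 := by
    refine Finset.sum_congr rfl fun u hu => ?_
    rw [if_neg (Finset.ne_of_mem_erase hu).symm, add_zero]
  rw [hrest]
  by_cases h0 : v = 0
  · simp [h0]
  · by_cases he : Even (treeDeg T v) <;> simp [h0, he, Nat.even_add_one] <;> omega

theorem sum_evenNonrootCount_succ (n : ℕ) (φ : ℕ → ℕ) :
    ∑ T : IncTree (n + 1), φ (evenNonrootCount T) =
      ∑ T : IncTree n, runWeight n φ (evenNonrootCount T) := by
  rw [← (attachLeaf_bijective n).sum_comp, Fintype.sum_prod_type]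
  refine Finset.sum_congr rfl fun T _ => ?_
  have hE : #{v ∈ univ.erase (0 : Fin (n + 1)) | Even (treeDeg T v)} = evenNonrootCount T := by
    rw [evenNonrootCount]
    congr 1
    ext v
    simp
  have hO : #{v ∈ univ.erase (0 : Fin (n + 1)) | ¬ Even (treeDeg T v)} =
      n - evenNonrootCount T := by
    have := Finset.card_filter_add_card_filter_not (s := univ.erase (0 : Fin (n + 1)))
      (fun v => Even (treeDeg T v))
    rw [hE, Finset.card_erase_of_mem (mem_univ _), Finset.card_univ, Fintype.card_fin] at this
    omega
  have hne : ∀ v ∈ univ.erase (0 : Fin (n + 1)), φ (evenNonrootCount (attachLeaf (T, v))) =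
      if Even (treeDeg T v) then φ (evenNonrootCount T) else φ (evenNonrootCount T + 2) := by
    intro v hv
    rw [evenNonrootCount_attachLeaf, if_neg (Finset.ne_of_mem_erase hv)]
    split_ifs <;> rfl
  rw [← Finset.add_sum_erase _ _ (mem_univ (0 : Fin (n + 1))), Finset.sum_congr rfl hne,
    Finset.sum_ite, Finset.sum_const, Finset.sum_const, hE, hO, evenNonrootCount_attachLeaf,
    if_pos rfl, runWeight]
  simp only [smul_eq_mul]
  ring

theorem sum_udRunCount_eq_sum_evenNonrootCount (n : ℕ) (φ : ℕ → ℕ) :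
    ∑ σ : Equiv.Perm (Fin n), φ (udRunCount n σ) = ∑ T : IncTree n, φ (evenNonrootCount T) := by
  induction n generalizing φ with
  | zero =>
    have h1 : ∀ T : IncTree 0, evenNonrootCount T = 0 := fun T => by
      simp [evenNonrootCount, Fin.fin_one_eq_zero]
    have h2 : Fintype.card (IncTree 0) = 1 := by decide
    simp [udRunCount, h1, h2]
  | succ n ih => rw [sum_udRunCount_succ, sum_evenNonrootCount_succ, ih]

/-- for `n ≥ 1` and `k ≥ 0`, the number of permutations of `[n]` with
exactly `k` up-down runs equals the number of increasing trees on `{0,1,…,n}` with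
exactly `k` nonroot vertices of even degree. -/
theorem stmt_18 (n k : ℕ) (hn : 1 ≤ n) :
    udRunNum n k = (Finset.univ.filter fun T : IncTree n => evenNonrootCount T = k).card := by
  rw [udRunNum, Finset.card_filter, Finset.card_filter]
  exact sum_udRunCount_eq_sum_evenNonrootCount n fun r => if r = k then 1 else 0
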